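/- Fix n, l ∈ ℕ with n > l. Equip ℂ[z₁,z₂] with the hermitian inner product determined by declaring distinct monomials orthogonal and ⟨z₁^a z₂^b, z₁^a z₂^b⟩ = a!·b!, and equip P_n ⊗ P_l with the induced product inner product. Let h = Σ_{k=0}^{l} (−1)^k binom(l,k) z₂^k z₁^{n−k} ⊗ z₁^k z₂^{l−k} and X₃ = ½(z₁∂₁ − z₂∂₂). Then ⟨h, (X₃⊗1)h⟩ / ⟨h, h⟩ = n/2 − l/(n−l+2). -/

import Mathlib

open MvPolynomial

/-- Multiplication by the variable `zᵢ` ("creation operator" `aᵢ† = zᵢ`). -/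
noncomputable def mulZ (i : Fin 2) : Module.End ℂ (MvPolynomial (Fin 2) ℂ) :=
  LinearMap.mulLeft ℂ (X i)

/-- The su(2) generators `X₁ = ½(z₁∂₂ + z₂∂₁)`, `X₂ = −(i/2)(z₁∂₂ − z₂∂₁)`,
`X₃ = ½(z₁∂₁ − z₂∂₂)` acting on `ℂ[z₁,z₂]` (variables indexed by `0, 1`,
operators indexed by `0, 1, 2`). -/
noncomputable def Xop : Fin 3 → Module.End ℂ (MvPolynomial (Fin 2) ℂ)
  | 0 => ((1:ℂ)/2) • (mulZ 0 ∘ₗ (pderiv (R := ℂ) (1 : Fin 2)).toLinearMap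
            + mulZ 1 ∘ₗ (pderiv (R := ℂ) (0 : Fin 2)).toLinearMap)
  | 1 => (-Complex.I/2) • (mulZ 0 ∘ₗ (pderiv (R := ℂ) (1 : Fin 2)).toLinearMap
            - mulZ 1 ∘ₗ (pderiv (R := ℂ) (0 : Fin 2)).toLinearMap)
  | 2 => ((1:ℂ)/2) • (mulZ 0 ∘ₗ (pderiv (R := ℂ) (0 : Fin 2)).toLinearMap
            - mulZ 1 ∘ₗ (pderiv (R := ℂ) (1 : Fin 2)).toLinearMap)

/-- The totally antisymmetric Levi-Civita symbol `ε_{abc}` on `{0,1,2}` with `ε₀₁₂ = 1`. -/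
noncomputable def eps (a b c : Fin 3) : ℂ :=
  (((b : ℤ) - (a : ℤ)) * ((c : ℤ) - (a : ℤ)) * ((c : ℤ) - (b : ℤ)) : ℂ) / 2


open TensorProduct

/-- The identity operator on `ℂ[z₁,z₂]`. -/
noncomputable def idP : Module.End ℂ (MvPolynomial (Fin 2) ℂ) := LinearMap.id

/-- The Bargmann hermitian inner product on a polynomial ring over `ℂ`: distinct monomials
are orthogonal and `⟨∏ zᵢ^{aᵢ}, ∏ zᵢ^{aᵢ}⟩ = ∏ aᵢ!` (conjugate-linear in the first
argument). -/
noncomputable def binner {σ : Type*} (p q : MvPolynomial σ ℂ) : ℂ :=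
  ∑ m ∈ p.support,
    (starRingEnd ℂ) (p.coeff m) * q.coeff m * (m.prod fun _ k => (k.factorial : ℂ))

/-- The canonical identification of `ℂ[z₁,z₂] ⊗ ℂ[z₁,z₂]` with the polynomial ring in two
pairs of variables, sending `p ⊗ q` to `p(z_left)·q(z_right)`. -/
noncomputable def phi :
    (MvPolynomial (Fin 2) ℂ ⊗[ℂ] MvPolynomial (Fin 2) ℂ) →ₐ[ℂ] MvPolynomial (Fin 2 ⊕ Fin 2) ℂ :=
  Algebra.TensorProduct.productMap (rename Sum.inl) (rename Sum.inr)

/-- The induced product inner product on `ℂ[z₁,z₂] ⊗ ℂ[z₁,z₂]`: on pure tensors,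
`⟨p₁ ⊗ p₂, q₁ ⊗ q₂⟩ = ⟨p₁,q₁⟩·⟨p₂,q₂⟩` for the Bargmann inner products of the factors. -/
noncomputable def tinner (x y : MvPolynomial (Fin 2) ℂ ⊗[ℂ] MvPolynomial (Fin 2) ℂ) : ℂ :=
  binner (phi x) (phi y)

theorem binner_sum_monomial {σ ι : Type*} (s : Finset ι) (e : ι → σ →₀ ℕ)
    (he : Set.InjOn e s) (a b : ι → ℂ) :
    binner (∑ k ∈ s, monomial (e k) (a k)) (∑ k ∈ s, monomial (e k) (b k)) =
      ∑ k ∈ s, (starRingEnd ℂ) (a k) * b k * ((e k).prod fun _ i => (i.factorial : ℂ)) := by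
  classical
  have hcoeff (c : ι → ℂ) {k : ι} (hk : k ∈ s) :
      coeff (e k) (∑ i ∈ s, monomial (e i) (c i)) = c k := by
    rw [coeff_sum, Finset.sum_eq_single k]
    · simp
    · intro i hi hik
      rw [coeff_monomial, if_neg fun h => hik (he hi hk h)]
    · exact fun h => absurd hk h
  have hsupp : (∑ k ∈ s, monomial (e k) (a k)).support ⊆ s.image e := by
    intro m hm
    obtain ⟨k, hk, hmk⟩ := Finset.mem_biUnion.1 (support_sum hm)
    exact Finset.mem_image.2 ⟨k, hk, (Finset.mem_singleton.1 (support_monomial_subset hmk)).symm⟩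
  rw [binner, Finset.sum_subset hsupp, Finset.sum_image he]
  · exact Finset.sum_congr rfl fun k hk => by rw [hcoeff a hk, hcoeff b hk]
  · intro m _ hm
    rw [notMem_support_iff.1 hm]
    simp

theorem Xop_two_monomial (a b : ℕ) :
    Xop 2 (X 1 ^ a * X 0 ^ b) = (((b : ℂ) - a) / 2) • (X 1 ^ a * X 0 ^ b) := by
  have hX (i : Fin 2) (m : ℕ) :
      (X i : MvPolynomial (Fin 2) ℂ) * (C (m : ℂ) * X i ^ (m - 1)) = C (m : ℂ) * X i ^ m := by
    cases m with
    | zero => simp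
    | succ m => rw [Nat.add_sub_cancel, pow_succ]; ring
  have h0 : pderiv 0 (X 1 ^ a * X 0 ^ b : MvPolynomial (Fin 2) ℂ) =
      X 1 ^ a * (C (b : ℂ) * X 0 ^ (b - 1)) := by
    simp [Derivation.leibniz, Derivation.leibniz_pow, pderiv_X]
  have h1 : pderiv 1 (X 1 ^ a * X 0 ^ b : MvPolynomial (Fin 2) ℂ) =
      X 0 ^ b * (C (a : ℂ) * X 1 ^ (a - 1)) := by
    simp [Derivation.leibniz, Derivation.leibniz_pow, pderiv_X]
  have hC : (C (((b : ℂ) - a) / 2) : MvPolynomial (Fin 2) ℂ) =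
      C (1 / 2) * (C (b : ℂ) - C (a : ℂ)) := by
    rw [← map_sub, ← map_mul]
    congr 1
    ring
  have hop : Xop 2 (X 1 ^ a * X 0 ^ b) = ((1 : ℂ) / 2) •
      (X 0 * pderiv 0 (X 1 ^ a * X 0 ^ b) - X 1 * pderiv 1 (X 1 ^ a * X 0 ^ b)) := rfl
  rw [hop, h0, h1, smul_eq_C_mul, smul_eq_C_mul, hC]
  linear_combination C (1 / 2 : ℂ) * (X 1 ^ a * hX 0 b - X 0 ^ b * hX 1 a)

/-- The exponent of the monomial `z₂^a z₁^b ⊗ z₁^c z₂^d`. -/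
noncomputable def tensorExponent (a b c d : ℕ) : Fin 2 ⊕ Fin 2 →₀ ℕ :=
  Finsupp.equivFunOnFinite.symm (Sum.elim ![b, a] ![c, d])

theorem tensorExponent_prod_factorial (a b c d : ℕ) :
    ((tensorExponent a b c d).prod fun _ i => (i.factorial : ℂ)) =
      a.factorial * b.factorial * (c.factorial * d.factorial) := by
  rw [Finsupp.prod_fintype _ _ (by simp)]
  simp [tensorExponent, mul_comm]

theorem phi_smul_tmul (r : ℂ) (a b c d : ℕ) :
    phi (r • ((X 1 ^ a * X 0 ^ b) ⊗ₜ[ℂ] (X 0 ^ c * X 1 ^ d))) =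
      monomial (tensorExponent a b c d) r := by
  rw [monomial_eq, Finsupp.prod_fintype _ _ (by simp), map_smul, smul_eq_C_mul]
  simp [phi, tensorExponent, mul_comm (X (Sum.inl 1 : Fin 2 ⊕ Fin 2) ^ a : MvPolynomial _ ℂ)]

theorem sum_range_sub_mul_add_choose (d l : ℕ) :
    ∑ j ∈ Finset.range (l + 1), ((l : ℂ) - j) * ((j + d).choose d : ℂ) =
      ((l + d + 1).choose (d + 2) : ℂ) := by
  induction l with
  | zero => simp
  | succ l ih =>
    rw [Finset.sum_range_succ, sub_self, zero_mul, add_zero, add_right_comm l 1 d,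
      Nat.choose_succ_succ (l + d + 1) (d + 1), Nat.cast_add (Nat.choose _ (d + 1)),
      Nat.succ_eq_add_one, add_assoc d 1 1, one_add_one_eq_two, ← ih,
      ← Nat.sum_range_add_choose, Nat.cast_sum, ← Finset.sum_add_distrib]
    refine Finset.sum_congr rfl fun j _ => ?_
    push_cast
    ring

theorem choose_sq_mul_factorials (d k j : ℕ) :
    (k + j).choose k ^ 2 * (k.factorial * (j + d).factorial * (k.factorial * j.factorial)) =
      (k + j).factorial ^ 2 * d.factorial * (j + d).choose d := by
  rw [← Nat.add_choose_mul_factorial_mul_factorial k j,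
    ← Nat.add_choose_mul_factorial_mul_factorial j d, Nat.choose_symm_add]
  ring

/-- For `h = Σ_{k=0}^{l} (−1)^k C(l,k) z₂^k z₁^{n−k} ⊗ z₁^k z₂^{l−k}` (with `n > l`) and
`X₃ = ½(z₁∂₁ − z₂∂₂)`, one has `⟨h,(X₃⊗1)h⟩/⟨h,h⟩ = n/2 − l/(n−l+2)`, i.e.
`pX₃|h⟩ = (n/2 − μ)|h⟩` with `μ = l/(n+2−l)`. -/
theorem mu_bottom (n l : ℕ) (hnl : l < n) :
    ∀ Xthree : Module.End ℂ (MvPolynomial (Fin 2) ℂ),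
      Xthree = Xop 2 →
    ∀ h : MvPolynomial (Fin 2) ℂ ⊗[ℂ] MvPolynomial (Fin 2) ℂ,
      h = ∑ k ∈ Finset.range (l + 1),
            ((-1 : ℂ) ^ k * (Nat.choose l k : ℂ)) •
              ((X 1 ^ k * X 0 ^ (n - k)) ⊗ₜ[ℂ] (X 0 ^ k * X 1 ^ (l - k))) →
      tinner h (TensorProduct.map Xthree idP h) / tinner h h
        = (n : ℂ) / 2 - (l : ℂ) / ((n : ℂ) - (l : ℂ) + 2) := by
  rintro _ rfl _ rfl
  obtain ⟨D, rfl⟩ := Nat.exists_eq_add_of_le hnl.le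
  set s := Finset.range (l + 1)
  set e : ℕ → Fin 2 ⊕ Fin 2 →₀ ℕ := fun k => tensorExponent k (l + D - k) k (l - k) with he_def
  set c : ℕ → ℂ := fun k => (-1) ^ k * (l.choose k : ℂ) with hc_def
  set x : ℕ → ℂ := fun k => (((l + D - k : ℕ) : ℂ) - k) / 2 with hx_def
  have he : Set.InjOn e s := fun i _ j _ hij => by
    simpa [he_def, tensorExponent] using DFunLike.congr_fun hij (Sum.inr 0)
  have hXh : TensorProduct.map (Xop 2) idP (∑ k ∈ s, c k •
        ((X 1 ^ k * X 0 ^ (l + D - k)) ⊗ₜ[ℂ] (X 0 ^ k * X 1 ^ (l - k)))) =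
      ∑ k ∈ s, (c k * x k) •
        ((X 1 ^ k * X 0 ^ (l + D - k)) ⊗ₜ[ℂ] (X 0 ^ k * X 1 ^ (l - k))) := by
    rw [map_sum]
    refine Finset.sum_congr rfl fun k _ => ?_
    rw [map_smul, TensorProduct.map_tmul, Xop_two_monomial, ← TensorProduct.smul_tmul',
      smul_smul, idP, LinearMap.id_apply]
  have hphi (r : ℕ → ℂ) : phi (∑ k ∈ s, r k •
        ((X 1 ^ k * X 0 ^ (l + D - k)) ⊗ₜ[ℂ] (X 0 ^ k * X 1 ^ (l - k)))) =
      ∑ k ∈ s, monomial (e k) (r k) := by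
    rw [map_sum]
    exact Finset.sum_congr rfl fun k _ => phi_smul_tmul _ _ _ _ _
  have hinner (y f : ℕ → ℂ) (hyf : ∀ j ∈ s, y (l - j) = f j) :
      binner (∑ k ∈ s, monomial (e k) (c k)) (∑ k ∈ s, monomial (e k) (c k * y k)) =
      (l.factorial : ℂ) ^ 2 * D.factorial * ∑ j ∈ s, f j * ((j + D).choose D : ℂ) := by
    rw [binner_sum_monomial s e he, ← Finset.sum_range_reflect, Finset.mul_sum]
    refine Finset.sum_congr rfl fun j hj => ?_
    have hjl : j ≤ l := Nat.lt_succ_iff.1 (Finset.mem_range.1 hj)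
    rw [Nat.add_sub_cancel, hyf j hj]
    obtain ⟨k, rfl⟩ := Nat.exists_eq_add_of_le' hjl
    have hsub : k + j + D - k = j + D := by omega
    have hw := congrArg (Nat.cast : ℕ → ℂ) (choose_sq_mul_factorials D k j)
    have hsq : ((-1 : ℂ) ^ k) ^ 2 = 1 := by rw [← pow_mul, mul_comm, pow_mul]; simp
    push_cast at hw
    simp only [he_def, hc_def, tensorExponent_prod_factorial, Nat.add_sub_cancel,
      Nat.add_sub_cancel_left, hsub, map_mul, map_pow, map_neg, map_one, map_natCast]
    linear_combination f j * hw + f j * ((k + j).choose k : ℂ) ^ 2 *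
      (k.factorial * (j + D).factorial * (k.factorial * j.factorial)) * hsq
  have hden := hinner (fun _ => 1) (fun _ => 1) fun _ _ => rfl
  have hnum := hinner x (fun j => ((l : ℂ) + D) / 2 - (l - j)) fun j hj => by
    have hjl : j ≤ l := Nat.lt_succ_iff.1 (Finset.mem_range.1 hj)
    simp only [hx_def]
    rw [Nat.cast_sub (by omega), Nat.cast_sub hjl]
    push_cast
    ring
  have hS : ∑ j ∈ s, ((j + D).choose D : ℂ) = ((l + D + 1).choose (D + 1) : ℂ) :=
    mod_cast Nat.sum_range_add_choose l D
  simp only [mul_one, one_mul, hS] at hden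
  simp only [sub_mul ((l + D : ℂ) / 2), Finset.sum_sub_distrib, ← Finset.mul_sum, hS,
    sum_range_sub_mul_add_choose, s] at hnum
  rw [tinner, tinner, hXh, hphi, hphi, hnum, hden]
  have hratio : ((l + D + 1).choose (D + 2) : ℂ) * (D + 2) = (l + D + 1).choose (D + 1) * l := by
    have h := Nat.choose_succ_right_eq (l + D + 1) (D + 1)
    rw [show l + D + 1 - (D + 1) = l by omega] at h
    exact_mod_cast h
  have hS0 : ((l + D + 1).choose (D + 1) : ℂ) ≠ 0 :=
    Nat.cast_ne_zero.2 (Nat.choose_pos (by omega)).ne'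
  have hl0 : (l.factorial : ℂ) ≠ 0 := Nat.cast_ne_zero.2 l.factorial_ne_zero
  have hD0 : (D.factorial : ℂ) ≠ 0 := Nat.cast_ne_zero.2 D.factorial_ne_zero
  have hD2 : (D : ℂ) + 2 ≠ 0 := by exact_mod_cast (D + 1).succ_ne_zero
  rw [mul_div_mul_left _ _ (mul_ne_zero (pow_ne_zero 2 hl0) hD0), Nat.cast_add,
    add_sub_cancel_left, sub_div, mul_div_cancel_right₀ _ hS0]
  congr 1
  rw [div_eq_div_iff hS0 hD2, hratio, mul_comm]
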